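/- arXiv:1310.3414 — 2 statements merged into one kernel-verified Lean document; each statement's English description precedes it below -/
import Mathlib

section
/- Let (S,E) and (S',E') be finite simple graphs. If the Lie algebras n(S,E) and n(S',E') over k are isomorphic as Lie algebras, then the graphs (S,E) and (S',E') are isomorphic. -/
open ExteriorAlgebra

variable (k : Type*) [Field k]

section Wedge

variable {M : Type*} [AddCommGroup M] [Module k M]

/-- The wedge `v ∧ w` of two vectors, as an element of the second exterior power `⋀[k]^2 M`. -/
def wedge (v w : M) : ⋀[k]^2 M :=
  ⟨ι k v * ι k w, by
    show _ ∈ (LinearMap.range (ι k : M →ₗ[k] ExteriorAlgebra k M)) ^ 2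
    rw [pow_two]
    exact Submodule.mul_mem_mul (LinearMap.mem_range_self _ v) (LinearMap.mem_range_self _ w)⟩

theorem wedge_add_left (v v' w : M) :
    wedge k (v + v') w = wedge k v w + wedge k v' w :=
  Subtype.ext <| by simp [wedge, add_mul]

theorem wedge_add_right (v w w' : M) :
    wedge k v (w + w') = wedge k v w + wedge k v w' :=
  Subtype.ext <| by simp [wedge, mul_add]

theorem wedge_smul_left (t : k) (v w : M) :
    wedge k (t • v) w = t • wedge k v w :=
  Subtype.ext <| by simp [wedge, smul_mul_assoc]

theorem wedge_smul_right (t : k) (v w : M) :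
    wedge k v (t • w) = t • wedge k v w :=
  Subtype.ext <| by simp [wedge, mul_smul_comm]

theorem wedge_self (v : M) : wedge k v v = 0 :=
  Subtype.ext <| ι_sq_zero v

theorem wedge_zero_left (w : M) : wedge k 0 w = 0 :=
  Subtype.ext <| by simp [wedge]

theorem wedge_zero_right (v : M) : wedge k v 0 = 0 :=
  Subtype.ext <| by simp [wedge]

end Wedge

section Graph

variable (S : Type*) [DecidableEq S]

/-- The subspace `W ⊆ ⋀²V` spanned by the wedges `α ∧ β` of distinct non-adjacent vertices,
where `V = S → k` has standard basis indexed by the vertex set `S`. -/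
def graphW (G : SimpleGraph S) : Submodule k (⋀[k]^2 (S → k)) :=
  Submodule.span k
    {x | ∃ α β : S, α ≠ β ∧ ¬ G.Adj α β ∧
      x = wedge k (Pi.single α (1 : k)) (Pi.single β (1 : k))}

/-- The underlying vector space `V ⊕ (⋀²V)/W` of the two-step nilpotent Lie algebra `n(S,E)`
associated with a finite simple graph. -/
abbrev graphLie (G : SimpleGraph S) :=
  (S → k) × ((⋀[k]^2 (S → k)) ⧸ graphW k S G)

variable {S}
variable (G : SimpleGraph S)

instance : LieRing (graphLie k S G) where
  bracket p q := (0, Submodule.Quotient.mk (wedge k p.1 q.1))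
  add_lie p q r := by
    refine Prod.ext (by simp) ?_
    show Submodule.Quotient.mk (wedge k (p.1 + q.1) r.1) = _
    rw [wedge_add_left, Submodule.Quotient.mk_add]
    rfl
  lie_add p q r := by
    refine Prod.ext (by simp) ?_
    show Submodule.Quotient.mk (wedge k p.1 (q.1 + r.1)) = _
    rw [wedge_add_right, Submodule.Quotient.mk_add]
    rfl
  lie_self p := by
    refine Prod.ext rfl ?_
    show Submodule.Quotient.mk (wedge k p.1 p.1) = 0
    rw [wedge_self, Submodule.Quotient.mk_zero]
  leibniz_lie p q r := by
    refine Prod.ext (by simp) ?_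
    show Submodule.Quotient.mk (wedge k p.1 (0 : S → k)) =
      Submodule.Quotient.mk (wedge k (0 : S → k) r.1) +
        Submodule.Quotient.mk (wedge k q.1 (0 : S → k))
    simp [wedge_zero_left, wedge_zero_right]

instance : LieAlgebra k (graphLie k S G) where
  lie_smul t p q := by
    refine Prod.ext (show (0 : S → k) = t • 0 by simp) ?_
    show Submodule.Quotient.mk (wedge k p.1 (t • q.1)) = _
    rw [wedge_smul_right, Submodule.Quotient.mk_smul]
    rfl

theorem graphLie_bracket (p q : graphLie k S G) :
    ⁅p, q⁆ = (0, Submodule.Quotient.mk (wedge k p.1 q.1)) := rfl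

end Graph

section Commutation

variable {k}
variable {S S' : Type*} {G : SimpleGraph S} {G' : SimpleGraph S'}

/-- The coordinate form of the vanishing of the bracket of two vectors in `n(S,E)`. -/
def GraphCommute (G : SimpleGraph S) (v w : S → k) : Prop :=
  ∀ a b, G.Adj a b → v a * w b = v b * w a

/-- The subspace of vectors commuting with `v`. -/
def graphCentralizer (G : SimpleGraph S) (v : S → k) : Submodule k (S → k) where
  carrier := {w | GraphCommute G v w}
  add_mem' {x y} hx hy a b hab := by
    have h₁ := hx a b hab
    have h₂ := hy a b hab
    simp only [Pi.add_apply]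
    linear_combination h₁ + h₂
  zero_mem' a b _ := by simp
  smul_mem' t x hx a b hab := by
    have h₁ := hx a b hab
    simp only [Pi.smul_apply, smul_eq_mul]
    linear_combination t * h₁

/-- The number of vertices (including `a` itself) that are not adjacent to `a`. -/
noncomputable def nonAdjCard (G : SimpleGraph S) (a : S) : ℕ :=
  Nat.card {x // ¬ G.Adj a x}

/-- Restriction of vectors commuting with `v` to the vertices not adjacent to `a`. -/
def centralizerRestrict (G : SimpleGraph S) (v : S → k) (a : S) :
    graphCentralizer G v →ₗ[k] ({x // ¬ G.Adj a x} → k) :=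
  LinearMap.funLeft k k Subtype.val ∘ₗ (graphCentralizer G v).subtype

@[simp]
theorem centralizerRestrict_apply (v : S → k) (a : S) (w : graphCentralizer G v)
    (x : {x // ¬ G.Adj a x}) : centralizerRestrict G v a w x = w.1 x := rfl

theorem centralizerRestrict_injective {v : S → k} {a : S} (ha : v a ≠ 0) :
    Function.Injective (centralizerRestrict G v a) := by
  rw [injective_iff_map_eq_zero]
  intro w hw
  have h0 (x : S) (hx : ¬ G.Adj a x) : w.1 x = 0 := congrFun hw ⟨x, hx⟩
  ext x
  by_cases hx : G.Adj a x
  · have := w.2 a x hx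
    rw [h0 a (G.loopless.irrefl a), mul_zero] at this
    exact (mul_eq_zero.mp this).resolve_left ha
  · exact h0 x hx

theorem finrank_nonAdj [Finite S] (a : S) :
    Module.finrank k ({x // ¬ G.Adj a x} → k) = nonAdjCard G a := by
  classical
  have := Fintype.ofFinite {x // ¬ G.Adj a x}
  rw [Module.finrank_fintype_fun_eq_card, nonAdjCard, Nat.card_eq_fintype_card]

theorem finrank_graphCentralizer_le [Finite S] {v : S → k} {a : S} (ha : v a ≠ 0) :
    Module.finrank k (graphCentralizer G v) ≤ nonAdjCard G a := by
  rw [← finrank_nonAdj (k := k)]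
  exact LinearMap.finrank_le_finrank_of_injective (centralizerRestrict_injective ha)

theorem finrank_graphCentralizer_single [Finite S] [DecidableEq S] (a : S) :
    Module.finrank k (graphCentralizer G (Pi.single a (1 : k))) = nonAdjCard G a := by
  classical
  rw [← finrank_nonAdj (k := k)]
  refine LinearEquiv.finrank_eq (LinearEquiv.ofBijective (centralizerRestrict G _ a)
    ⟨centralizerRestrict_injective (by simp), fun f => ?_⟩)
  refine ⟨⟨fun x => if h : G.Adj a x then 0 else f ⟨x, h⟩, fun b c hbc => ?_⟩, ?_⟩
  · by_cases hb : b = a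
    · subst hb
      simp [hbc, hbc.ne']
    · by_cases hc : c = a
      · subst hc
        simp [hbc.symm, hb]
      · simp [hb, hc]
  · ext x
    simp [x.2]

/-- If the centralizer of `v` has the largest dimension its support vertex `a` allows, then any
support vertex not adjacent to `a` is dominated by `a`. -/
theorem adj_of_finrank_eq [Finite S] {v : S → k} {a b x : S} (ha : v a ≠ 0)
    (hv : Module.finrank k (graphCentralizer G v) = nonAdjCard G a) (hb : v b ≠ 0)
    (hab : ¬ G.Adj a b) (hbx : G.Adj b x) : G.Adj a x := by
  classical
  by_contra hax
  have hsurj : Function.Surjective (centralizerRestrict G v a) :=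
    (LinearMap.injective_iff_surjective_of_finrank_eq_finrank
      (hv.trans (finrank_nonAdj a).symm)).mp (centralizerRestrict_injective ha)
  obtain ⟨w, hw⟩ := hsurj (Pi.single ⟨x, hax⟩ 1)
  have hwx : w.1 x = 1 := by simpa using congrFun hw ⟨x, hax⟩
  have hwb : w.1 b = 0 := by simpa [hbx.ne] using congrFun hw ⟨b, hab⟩
  have := w.2 b x hbx
  rw [hwx, hwb, mul_one, mul_zero] at this
  exact hb this

theorem adj_of_forall_adj [Finite S] {a x : S} (hc : nonAdjCard G x = nonAdjCard G a)
    (h : ∀ y, G.Adj x y → G.Adj a y) {b : S} (hab : G.Adj a b) : G.Adj x b := by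
  have hsub : {y | ¬ G.Adj a y} ⊆ {y | ¬ G.Adj x y} := fun y hy hxy => hy (h y hxy)
  have heq := Set.eq_of_subset_of_ncard_le hsub hc.le (Set.toFinite _)
  by_contra hxb
  exact (heq.symm.subset hxb : ¬ G.Adj a b) hab

section Equiv

variable {T : (S → k) ≃ₗ[k] (S' → k)}

theorem graphCommute_symm_iff (hT : ∀ v w, GraphCommute G v w ↔ GraphCommute G' (T v) (T w))
    (v w : S' → k) : GraphCommute G' v w ↔ GraphCommute G (T.symm v) (T.symm w) := by
  rw [hT, T.apply_symm_apply, T.apply_symm_apply]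

theorem finrank_graphCentralizer_map
    (hT : ∀ v w, GraphCommute G v w ↔ GraphCommute G' (T v) (T w)) (v : S → k) :
    Module.finrank k (graphCentralizer G' (T v)) = Module.finrank k (graphCentralizer G v) := by
  have : (graphCentralizer G v).map (T : (S → k) →ₗ[k] (S' → k)) = graphCentralizer G' (T v) := by
    ext y
    constructor
    · rintro ⟨w, hw, rfl⟩
      exact (hT v w).mp hw
    · intro hy
      refine ⟨T.symm y, (hT v _).mpr ?_, T.apply_symm_apply y⟩
      rw [T.apply_symm_apply]
      exact hy
  rw [← this]
  exact LinearEquiv.finrank_map_eq T _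

theorem finrank_graphCentralizer_map_single [Finite S] [DecidableEq S]
    (hT : ∀ v w, GraphCommute G v w ↔ GraphCommute G' (T v) (T w)) (a : S) :
    Module.finrank k (graphCentralizer G' (T (Pi.single a 1))) = nonAdjCard G a :=
  (finrank_graphCentralizer_map hT _).trans (finrank_graphCentralizer_single a)

theorem nonAdjCard_le_of_apply_ne_zero [Finite S] [Finite S'] [DecidableEq S]
    (hT : ∀ v w, GraphCommute G v w ↔ GraphCommute G' (T v) (T w)) {a : S} {x : S'}
    (h : T (Pi.single a 1) x ≠ 0) : nonAdjCard G a ≤ nonAdjCard G' x :=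
  (finrank_graphCentralizer_map_single hT a).symm.trans_le (finrank_graphCentralizer_le h)

end Equiv

theorem exists_apply_single_ne_zero [Fintype S] [DecidableEq S]
    {u : S → k} (T : (S → k) →ₗ[k] (S' → k)) {y : S'} (h : T u y ≠ 0) :
    ∃ x, u x ≠ 0 ∧ T (Pi.single x 1) y ≠ 0 := by
  by_contra! hcon
  apply h
  rw [LinearMap.pi_apply_eq_sum_univ T u, Finset.sum_apply]
  refine Finset.sum_eq_zero fun x _ => ?_
  by_cases hx : u x = 0
  · simp [hx]
  · have := hcon x hx
    rw [show (fun j => if x = j then (1 : k) else 0) = Pi.single x 1 by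
      ext j; simp [Pi.single_apply, eq_comm]]
    simp [this]

theorem exists_equiv_apply_ne_zero [Fintype S] [Fintype S'] [DecidableEq S]
    (T : (S → k) ≃ₗ[k] (S' → k)) : ∃ σ : S ≃ S', ∀ a, T (Pi.single a 1) (σ a) ≠ 0 := by
  classical
  have hcard : Fintype.card S = Fintype.card S' := by
    simpa using T.finrank_eq
  let e : S ≃ S' := Fintype.equivOfCardEq hcard
  let F : (S' → k) ≃ₗ[k] (S' → k) := (LinearEquiv.funCongrLeft k k e).trans T
  have hdet : (LinearMap.toMatrix' (F : (S' → k) →ₗ[k] (S' → k))).det ≠ 0 := by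
    rw [LinearMap.det_toMatrix']
    exact (LinearEquiv.isUnit_det' F).ne_zero
  rw [Matrix.det_apply] at hdet
  obtain ⟨τ, -, hτ⟩ := Finset.exists_ne_zero_of_sum_ne_zero hdet
  refine ⟨e.trans τ, fun a => ?_⟩
  have hprod : ∏ i, LinearMap.toMatrix' (F : (S' → k) →ₗ[k] (S' → k)) (τ i) i ≠ 0 :=
    fun h => hτ (by rw [h, smul_zero])
  have := Finset.prod_ne_zero_iff.mp hprod (e a) (Finset.mem_univ _)
  rw [LinearMap.toMatrix'_apply] at this
  have hF : F (Pi.single (e a) 1) = T (Pi.single a 1) := by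
    refine congrArg T (funext fun x => ?_)
    simp [LinearEquiv.funCongrLeft_apply, LinearMap.funLeft_apply, Pi.single_apply]
  rwa [LinearEquiv.coe_coe, hF] at this

section Iso

variable [Fintype S] [Fintype S'] [DecidableEq S] [DecidableEq S']
  {T : (S → k) ≃ₗ[k] (S' → k)}

theorem nonAdjCard_equiv (hT : ∀ v w, GraphCommute G v w ↔ GraphCommute G' (T v) (T w))
    {σ : S ≃ S'} (hσ : ∀ a, T (Pi.single a 1) (σ a) ≠ 0) (a : S) :
    nonAdjCard G' (σ a) = nonAdjCard G a := by
  obtain ⟨τ, hτ⟩ := exists_equiv_apply_ne_zero T.symm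
  have hle (a : S) : nonAdjCard G a ≤ nonAdjCard G' (σ a) :=
    nonAdjCard_le_of_apply_ne_zero hT (hσ a)
  have hle' (x : S') : nonAdjCard G' x ≤ nonAdjCard G (τ x) :=
    nonAdjCard_le_of_apply_ne_zero (graphCommute_symm_iff hT) (hτ x)
  have hsum : ∑ a, nonAdjCard G a = ∑ a, nonAdjCard G' (σ a) := by
    refine le_antisymm (Finset.sum_le_sum fun a _ => hle a) ?_
    rw [Equiv.sum_comp σ (nonAdjCard G'), ← Equiv.sum_comp τ (nonAdjCard G)]
    exact Finset.sum_le_sum fun x _ => hle' x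
  exact ((Finset.sum_eq_sum_iff_of_le fun a _ => hle a).mp hsum a (Finset.mem_univ a)).symm

theorem not_adj_equiv (hT : ∀ v w, GraphCommute G v w ↔ GraphCommute G' (T v) (T w))
    {σ : S ≃ S'} (hσ : ∀ a, T (Pi.single a 1) (σ a) ≠ 0) {α β : S} (hne : α ≠ β)
    (hαβ : ¬ G.Adj α β) : ¬ G'.Adj (σ α) (σ β) := by
  intro hab
  set v := T (Pi.single α 1) with hv
  set w := T (Pi.single β 1) with hw
  have hcomm : GraphCommute G' v w := by
    refine (hT _ _).mp fun x y hxy => ?_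
    simp only [Pi.single_apply]
    split_ifs <;> simp_all [G.adj_comm]
  have hva : v (σ α) ≠ 0 := hσ α
  have hwb : w (σ β) ≠ 0 := hσ β
  have hvw := hcomm _ _ hab
  have hprod : v (σ β) * w (σ α) ≠ 0 := hvw ▸ mul_ne_zero hva hwb
  have hvb := left_ne_zero_of_mul hprod
  have hwa := right_ne_zero_of_mul hprod
  have hα := nonAdjCard_equiv hT hσ α
  have hβ := nonAdjCard_equiv hT hσ β
  have hle₁ : nonAdjCard G α ≤ nonAdjCard G' (σ β) := nonAdjCard_le_of_apply_ne_zero hT hvb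
  have hle₂ : nonAdjCard G β ≤ nonAdjCard G' (σ α) := nonAdjCard_le_of_apply_ne_zero hT hwa
  have hcard : nonAdjCard G β = nonAdjCard G α := by omega
  have key (z : S' → k) (hz : Module.finrank k (graphCentralizer G' z) = nonAdjCard G α)
      (hza : z (σ α) ≠ 0) (x : S') (hzx : z x ≠ 0) (hx : nonAdjCard G' x = nonAdjCard G α)
      (hax : ¬ G'.Adj (σ α) x) : G'.Adj x (σ β) :=
    adj_of_forall_adj (hx.trans hα.symm)
      (fun y hy => adj_of_finrank_eq hza (hz.trans hα.symm) hzx hax hy) hab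
  have hzv : Module.finrank k (graphCentralizer G' v) = nonAdjCard G α :=
    finrank_graphCentralizer_map_single hT α
  have hzw : Module.finrank k (graphCentralizer G' w) = nonAdjCard G α :=
    (finrank_graphCentralizer_map_single hT β).trans hcard
  -- The combination of `v` and `w` vanishing at `σ α` has support of strictly smaller degree.
  set u := w (σ α) • v - v (σ α) • w with hu
  have hsupp (x : S') (hx : u x ≠ 0) : nonAdjCard G α < nonAdjCard G' x := by
    have hux : u x = w (σ α) * v x - v (σ α) * w x := rfl
    have hor : v x ≠ 0 ∨ w x ≠ 0 := by
      by_contra! h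
      exact hx (by rw [hux, h.1, h.2, mul_zero, mul_zero, sub_zero])
    have hle : nonAdjCard G α ≤ nonAdjCard G' x := hor.elim
      (fun h => nonAdjCard_le_of_apply_ne_zero hT h)
      (fun h => hcard ▸ nonAdjCard_le_of_apply_ne_zero hT h)
    refine lt_of_le_of_ne hle fun heq => hx ?_
    by_cases hax : G'.Adj (σ α) x
    · have := hcomm _ _ hax
      rw [hux]
      linear_combination -this
    · have hxb : G'.Adj x (σ β) := hor.elim
        (fun h => key v hzv hva x h heq.symm hax) (fun h => key w hzw hwa x h heq.symm hax)
      have := hcomm _ _ hxb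
      refine (mul_eq_zero.mp (?_ : w (σ β) * u x = 0)).resolve_left hwb
      rw [hux]
      linear_combination w (σ α) * this - w x * hvw
  have hTu : T.symm u = w (σ α) • Pi.single α 1 - v (σ α) • Pi.single β 1 := by
    rw [hu, map_sub, map_smul, map_smul, hv, hw, T.symm_apply_apply, T.symm_apply_apply]
  have hne0 : T.symm u α ≠ 0 := by
    rw [hTu]
    simpa [hne] using hwa
  obtain ⟨x, hux, hx⟩ :=
    exists_apply_single_ne_zero (T.symm : (S' → k) →ₗ[k] (S → k)) hne0
  have : nonAdjCard G' x ≤ nonAdjCard G α :=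
    nonAdjCard_le_of_apply_ne_zero (graphCommute_symm_iff hT) hx
  exact absurd (hsupp x hux) this.not_gt

theorem nonempty_iso_of_graphCommute_iff
    (hT : ∀ v w, GraphCommute G v w ↔ GraphCommute G' (T v) (T w)) : Nonempty (G ≃g G') := by
  obtain ⟨σ, hσ⟩ := exists_equiv_apply_ne_zero T
  refine ⟨⟨σ, fun {a b} => ⟨fun h => ?_, fun h => ?_⟩⟩⟩
  · by_contra hab
    exact not_adj_equiv hT hσ (fun e => h.ne (congrArg σ e)) hab h
  · have hsub : σ '' {x | ¬ G.Adj a x} ⊆ {y | ¬ G'.Adj (σ a) y} := by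
      rintro _ ⟨x, hx, rfl⟩
      by_cases hax : a = x
      · subst hax
        exact G'.loopless.irrefl _
      · exact not_adj_equiv hT hσ hax hx
    have heq := Set.eq_of_subset_of_ncard_le hsub
      (by
        rw [Set.ncard_image_of_injective _ σ.injective]
        exact (nonAdjCard_equiv hT hσ a).le) (Set.toFinite _)
    by_contra hab
    obtain ⟨x, hx, hxb⟩ := heq.symm.subset hab
    exact hx (σ.injective hxb ▸ h)

end Iso

end Commutation

section Bracket

variable {k}
variable {S S' : Type*}

/-- The functional on `⋀²V` sending `v ∧ w` to its `(a, b)` minor. -/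
noncomputable def wedgeMinor (a b : S) : ⋀[k]^2 (S → k) →ₗ[k] k :=
  exteriorPower.alternatingMapLinearEquiv
    ((Matrix.detRowAlternating (n := Fin 2) (R := k)).compLinearMap
      (LinearMap.funLeft k k ![a, b]))

theorem wedge_eq_ιMulti {M : Type*} [AddCommGroup M] [Module k M] (v w : M) :
    wedge k v w = exteriorPower.ιMulti k 2 ![v, w] := by
  apply Subtype.ext
  simp [wedge, exteriorPower.ιMulti_apply_coe, ExteriorAlgebra.ιMulti_apply]

theorem wedgeMinor_wedge (a b : S) (v w : S → k) :
    wedgeMinor a b (wedge k v w) = v a * w b - v b * w a := by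
  rw [wedge_eq_ιMulti, wedgeMinor, exteriorPower.alternatingMapLinearEquiv_apply_ιMulti]
  refine (Matrix.det_fin_two _).trans ?_
  simp [LinearMap.funLeft_apply]

variable [DecidableEq S] [DecidableEq S'] {G : SimpleGraph S} {G' : SimpleGraph S'}

theorem wedgeMinor_eq_zero_of_mem {a b : S} (hab : G.Adj a b) {y : ⋀[k]^2 (S → k)}
    (hy : y ∈ graphW k S G) : wedgeMinor a b y = 0 := by
  suffices graphW k S G ≤ LinearMap.ker (wedgeMinor a b) from this hy
  refine Submodule.span_le.mpr ?_
  rintro _ ⟨α, β, hne, hnadj, rfl⟩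
  rw [SetLike.mem_coe, LinearMap.mem_ker, wedgeMinor_wedge]
  simp only [Pi.single_apply]
  split_ifs <;> simp_all [G.adj_comm]

theorem wedge_mem_graphW_of_graphCommute [Fintype S] (hk : ringChar k ≠ 2) {v w : S → k}
    (h : GraphCommute G v w) : wedge k v w ∈ graphW k S G := by
  let B : (S → k) →ₗ[k] (S → k) →ₗ[k] ⋀[k]^2 (S → k) :=
    LinearMap.mk₂ k (wedge k) (wedge_add_left k) (wedge_smul_left k) (wedge_add_right k)
      (wedge_smul_right k)
  let e : S → S → k := fun a => Pi.single a 1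
  have hexp (v w : S → k) :
      wedge k v w = ∑ a, ∑ b, (v a * w b) • wedge k (e a) (e b) := by
    have hv (v : S → k) : v = ∑ a, v a • e a := by
      ext x
      simp [e, Finset.sum_apply, Pi.single_apply]
    change B v w = ∑ a, ∑ b, (v a * w b) • B (e a) (e b)
    conv_lhs => rw [hv v, hv w]
    simp only [map_sum, LinearMap.sum_apply, map_smul, LinearMap.smul_apply, Finset.smul_sum,
      smul_smul]
    rw [Finset.sum_comm]
    exact Finset.sum_congr rfl fun a _ => Finset.sum_congr rfl fun b _ => by rw [mul_comm]
  have hanti : wedge k w v = - wedge k v w := by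
    have := wedge_self k (v + w)
    rw [wedge_add_left, wedge_add_right, wedge_add_right, wedge_self, wedge_self, zero_add,
      add_zero] at this
    exact (neg_eq_of_add_eq_zero_right this).symm
  have htwo : (2 : k) • wedge k v w =
      ∑ a, ∑ b, (v a * w b - w a * v b) • wedge k (e a) (e b) := by
    have h₂ : (2 : k) • wedge k v w = wedge k v w - wedge k w v := by
      rw [hanti, two_smul, sub_neg_eq_add]
    rw [h₂, hexp v w, hexp w v, ← Finset.sum_sub_distrib]
    refine Finset.sum_congr rfl fun a _ => ?_
    rw [← Finset.sum_sub_distrib]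
    exact Finset.sum_congr rfl fun b _ => (sub_smul _ _ _).symm
  have hmem : (2 : k) • wedge k v w ∈ graphW k S G := by
    rw [htwo]
    refine Submodule.sum_mem _ fun a _ => Submodule.sum_mem _ fun b _ => ?_
    by_cases hab : G.Adj a b
    · rw [h a b hab, mul_comm, sub_self, zero_smul]
      exact Submodule.zero_mem _
    · by_cases hne : a = b
      · rw [hne, wedge_self, smul_zero]
        exact Submodule.zero_mem _
      · exact Submodule.smul_mem _ _ (Submodule.subset_span ⟨a, b, hne, hab, rfl⟩)
  exact (Submodule.smul_mem_iff _ (Ring.two_ne_zero hk)).mp hmem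

theorem lie_eq_zero_iff_graphCommute [Fintype S] (hk : ringChar k ≠ 2) (p q : graphLie k S G) :
    ⁅p, q⁆ = 0 ↔ GraphCommute G p.1 q.1 := by
  rw [graphLie_bracket, Prod.mk_eq_zero, Submodule.Quotient.mk_eq_zero]
  refine ⟨fun h a b hab => ?_, fun h => ⟨rfl, wedge_mem_graphW_of_graphCommute hk h⟩⟩
  exact sub_eq_zero.mp ((wedgeMinor_wedge a b _ _).symm.trans (wedgeMinor_eq_zero_of_mem hab h.2))

theorem fst_map_inr (L : graphLie k S G →ₗ⁅k⁆ graphLie k S' G')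
    (z : (⋀[k]^2 (S → k)) ⧸ graphW k S G) : (L (0, z)).1 = 0 := by
  obtain ⟨y, rfl⟩ := Submodule.Quotient.mk_surjective _ z
  let φ : ⋀[k]^2 (S → k) →ₗ[k] (S' → k) :=
    LinearMap.fst k _ _ ∘ₗ (L : graphLie k S G →ₗ[k] graphLie k S' G') ∘ₗ
      LinearMap.inr k (S → k) _ ∘ₗ (graphW k S G).mkQ
  have hφ : φ = 0 := by
    refine LinearMap.ext_on (exteriorPower.ιMulti_span k 2 (S → k)) ?_
    rintro _ ⟨f, rfl⟩
    have hf : exteriorPower.ιMulti k 2 f = wedge k (f 0) (f 1) := by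
      rw [wedge_eq_ιMulti]
      congr 1
      ext i
      fin_cases i <;> rfl
    rw [hf]
    change (L ⁅((f 0, 0) : graphLie k S G), ((f 1, 0) : graphLie k S G)⁆).1 = 0
    rw [LieHom.map_lie]
    rfl
  exact LinearMap.congr_fun hφ y

theorem fst_map_eq (L : graphLie k S G →ₗ⁅k⁆ graphLie k S' G') (p : graphLie k S G) :
    (L p).1 = (L (p.1, 0)).1 := by
  have hp : p = (p.1, 0) + (0, p.2) := by simp
  conv_lhs => rw [hp, map_add, Prod.fst_add, fst_map_inr, add_zero]

/-- The map on the quotients by the derived algebras induced by an isomorphism. -/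
def abelianizedEquiv (L : graphLie k S G ≃ₗ⁅k⁆ graphLie k S' G') : (S → k) ≃ₗ[k] (S' → k) :=
  LinearEquiv.ofLinearMap
    (LinearMap.fst k _ _ ∘ₗ (L.toLieHom : graphLie k S G →ₗ[k] graphLie k S' G') ∘ₗ
      LinearMap.inl k _ _)
    (LinearMap.fst k _ _ ∘ₗ (L.symm.toLieHom : graphLie k S' G' →ₗ[k] graphLie k S G) ∘ₗ
      LinearMap.inl k _ _)
    (LinearMap.ext fun v => by
      change (L.toLieHom ((L.symm (v, 0)).1, 0)).1 = v
      rw [← fst_map_eq]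
      exact congrArg Prod.fst (L.apply_symm_apply (v, 0)))
    (LinearMap.ext fun v => by
      change (L.symm.toLieHom ((L (v, 0)).1, 0)).1 = v
      rw [← fst_map_eq]
      exact congrArg Prod.fst (L.symm_apply_apply (v, 0)))

theorem graphCommute_abelianizedEquiv [Fintype S] [Fintype S'] (hk : ringChar k ≠ 2)
    (L : graphLie k S G ≃ₗ⁅k⁆ graphLie k S' G') (v w : S → k) :
    GraphCommute G v w ↔ GraphCommute G' (abelianizedEquiv L v) (abelianizedEquiv L w) := by
  rw [← lie_eq_zero_iff_graphCommute hk ((v, 0) : graphLie k S G) (w, 0)]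
  change _ ↔ GraphCommute G' (L (v, 0)).1 (L (w, 0)).1
  rw [← lie_eq_zero_iff_graphCommute hk, ← LieEquiv.map_lie, EmbeddingLike.map_eq_zero_iff]

end Bracket

/-- If the Lie algebras `n(S,E)` and `n(S',E')` over `k` are isomorphic as Lie
algebras, then the graphs `(S,E)` and `(S',E')` are isomorphic. -/
theorem graph_iso_of_lie_iso
    (hk : ringChar k ≠ 2)
    (S S' : Type*) [Fintype S] [DecidableEq S] [Fintype S'] [DecidableEq S']
    (G : SimpleGraph S) (G' : SimpleGraph S')
    (h : Nonempty (graphLie k S G ≃ₗ⁅k⁆ graphLie k S' G')) :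
    Nonempty (G ≃g G') := by
  obtain ⟨L⟩ := h
  exact nonempty_iso_of_graphCommute_iff (graphCommute_abelianizedEquiv hk L)
end

section
/- If S' is a finite set and k is an infinite field, then there exist nonzero scalars d_α ∈ k for α ∈ S' such that for all α, β, γ, δ ∈ S', if d_α d_β = d_γ d_δ then {α, β} = {γ, δ} as unordered pairs. -/
open MvPolynomial in
/-- Products of two variables determine the unordered pair of their indices. -/
theorem MvPolynomial.sym2_eq_of_X_mul_X_eq {σ R : Type*} [CommSemiring R] [Nontrivial R]
    {a b c d : σ} (h : (X a * X b : MvPolynomial σ R) = X c * X d) : s(a, b) = s(c, d) := by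
  simp only [X, monomial_mul, mul_one] at h
  have h' := congrArg Finsupp.toMultiset (monomial_left_injective one_ne_zero h)
  simp only [map_add, Finsupp.toMultiset_single, one_smul, Multiset.singleton_add] at h'
  rw [Sym2.eq_iff]
  rcases Multiset.cons_eq_cons.1 h' with ⟨hac, hbd⟩ | ⟨-, cs, hb, hd⟩
  · exact .inl ⟨hac, by simpa using hbd⟩
  · rw [Multiset.singleton_eq_cons_iff] at hb hd
    exact .inr ⟨hd.1.symm, hb.1⟩

open MvPolynomial in
/-- Over an infinite domain, finitely many nonzero polynomials have a common nonvanishing point. -/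
theorem MvPolynomial.exists_forall_eval_ne_zero {σ R ι : Type*} [CommRing R] [IsDomain R]
    [Infinite R] [Finite ι] (p : ι → MvPolynomial σ R) (hp : ∀ i, p i ≠ 0) :
    ∃ x : σ → R, ∀ i, eval x (p i) ≠ 0 := by
  have := Fintype.ofFinite ι
  have h : ∏ i, p i ≠ 0 := Finset.prod_ne_zero_iff.2 fun i _ => hp i
  contrapose! h
  refine MvPolynomial.funext fun x => ?_
  obtain ⟨i, hi⟩ := h x
  rw [map_prod, map_zero]
  exact Finset.prod_eq_zero (Finset.mem_univ i) hi


/-- If `S'` is a finite set and `k` is an infinite field, then there exist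
nonzero scalars `d_α ∈ k` for `α ∈ S'` such that `d_α d_β = d_γ d_δ` implies
`{α, β} = {γ, δ}` as unordered pairs. -/
theorem exists_scalars_with_distinct_pairwise_products
    (k : Type*) [Field k] [Infinite k] (S' : Type*) [Finite S'] :
    ∃ d : S' → k, (∀ α, d α ≠ 0) ∧
      ∀ α β γ δ : S', d α * d β = d γ * d δ → s(α, β) = s(γ, δ) := by
  let Q := {q : (S' × S') × S' × S' // s(q.1.1, q.1.2) ≠ s(q.2.1, q.2.2)}
  let p : S' ⊕ Q → MvPolynomial S' k :=
    Sum.elim MvPolynomial.X fun q =>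
      MvPolynomial.X q.1.1.1 * MvPolynomial.X q.1.1.2 -
        MvPolynomial.X q.1.2.1 * MvPolynomial.X q.1.2.2
  obtain ⟨d, hd⟩ := MvPolynomial.exists_forall_eval_ne_zero p <| by
    rintro (α | q)
    · exact MvPolynomial.X_ne_zero α
    · exact sub_ne_zero.2 fun h => q.2 (MvPolynomial.sym2_eq_of_X_mul_X_eq h)
  refine ⟨d, fun α => by simpa [p] using hd (.inl α), fun α β γ δ h => ?_⟩
  by_contra hne
  exact hd (.inr ⟨((α, β), γ, δ), hne⟩) (by simp [p, h])
end
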